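/- Let G be a connected swm-graph. For k ≥ 0 define the reduced k-diagonal extension D^(k)(G) on the vertex set of G by: D^(0)(G) = G, and D^(k+1)(G) is obtained from D^(k)(G) by adding, for every induced 4-cycle of D^(k)(G) at least one of whose four edges is an edge of G, both diagonals of that 4-cycle as edges. Also, for m ≥ 1 let G^{Δ,m} be the graph on the vertex set of G in which two distinct vertices x,y are adjacent if and only if (x,y) is a Boolean pair of G with d_G(x,y) ≤ m. Then D^(k)(G) = G^{Δ,k+1} for every k ≥ 0. -/

import Mathlib

variable {V : Type*}

/-- Triangle condition (TC). -/
def TriangleCondition (G : SimpleGraph V) : Prop :=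
  ∀ u v w : V, G.Adj v w → G.dist u v = G.dist u w → 1 ≤ G.dist u v →
    ∃ x : V, G.Adj v x ∧ G.Adj w x ∧ G.dist u x + 1 = G.dist u v

/-- Quadrangle condition (QC). -/
def QuadrangleCondition (G : SimpleGraph V) : Prop :=
  ∀ u v w z : V, G.Adj z v → G.Adj z w → G.dist v w = 2 →
    G.dist u v = G.dist u w → G.dist u z = G.dist u v + 1 →
    ∃ x : V, G.Adj v x ∧ G.Adj w x ∧ G.dist u x + 1 = G.dist u v

def WeaklyModular (G : SimpleGraph V) : Prop :=
  TriangleCondition G ∧ QuadrangleCondition G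

/-- The metric interval `I(u,v)`. -/
def gInterval (G : SimpleGraph V) (u v : V) : Set V :=
  {x : V | G.dist u x + G.dist x v = G.dist u v}

/-- `G` contains an induced `K₄` minus an edge. -/
def HasInducedK4minus (G : SimpleGraph V) : Prop :=
  ∃ a b c d : V, G.Adj a b ∧ G.Adj a c ∧ G.Adj a d ∧ G.Adj b c ∧ G.Adj b d ∧
    c ≠ d ∧ ¬ G.Adj c d

/-- `G` contains an isometric `K₃,₃` minus an edge. -/
def HasIsometricK33minus (G : SimpleGraph V) : Prop :=
  ∃ a₁ a₂ a₃ b₁ b₂ b₃ : V,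
    G.Adj a₁ b₁ ∧ G.Adj a₁ b₂ ∧ G.Adj a₁ b₃ ∧
    G.Adj a₂ b₁ ∧ G.Adj a₂ b₂ ∧ G.Adj a₂ b₃ ∧
    G.Adj a₃ b₁ ∧ G.Adj a₃ b₂ ∧
    G.dist a₁ a₂ = 2 ∧ G.dist a₁ a₃ = 2 ∧ G.dist a₂ a₃ = 2 ∧
    G.dist b₁ b₂ = 2 ∧ G.dist b₁ b₃ = 2 ∧ G.dist b₂ b₃ = 2 ∧
    G.dist a₃ b₃ = 3

/-- `(p,q)` is a Boolean pair: with `k = d(p,q)`, there is an isometrically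
embedded `k`-cube inside the interval `I(p,q)`. -/
def BooleanPair (G : SimpleGraph V) (p q : V) : Prop :=
  ∃ f : (Fin (G.dist p q) → Bool) → V,
    (∀ A, f A ∈ gInterval G p q) ∧
    ∀ A B, G.dist (f A) (f B) = (Finset.univ.filter fun i => A i ≠ B i).card

/-- Induced 4-cycle `(a,b,c,d)`. -/
def InducedSquare (G : SimpleGraph V) (a b c d : V) : Prop :=
  G.Adj a b ∧ G.Adj b c ∧ G.Adj c d ∧ G.Adj d a ∧
    a ≠ c ∧ b ≠ d ∧ ¬ G.Adj a c ∧ ¬ G.Adj b d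

/-- The reduced `k`-diagonal extension of `G`: at each step, for every induced
4-cycle of the current graph having at least one edge in `G`, both diagonals
are added as edges. -/
def diagExt (G : SimpleGraph V) : ℕ → SimpleGraph V
  | 0 => G
  | k + 1 =>
      diagExt G k ⊔
        SimpleGraph.fromRel (fun x y =>
          ∃ a b : V, InducedSquare (diagExt G k) x a y b ∧
            (G.Adj x a ∨ G.Adj a y ∨ G.Adj y b ∨ G.Adj b x))

/-- `G^{Δ,m}`: two distinct vertices are adjacent iff they form a Boolean pair
of `G` at distance at most `m`. -/
def thickeningLe (G : SimpleGraph V) (m : ℕ) : SimpleGraph V :=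
  SimpleGraph.fromRel fun p q => BooleanPair G p q ∧ G.dist p q ≤ m

/-- The standing assumptions: a strongly weakly modular (swm) graph. -/
structure IsSwm (G : SimpleGraph V) : Prop where
  connected : G.Connected
  triangle : TriangleCondition G
  quadrangle : QuadrangleCondition G
  not_K4minus : ¬ HasInducedK4minus G
  not_K33minus : ¬ HasIsometricK33minus G

namespace IsSwm

open SimpleGraph

variable {G : SimpleGraph V}

/-- All metric consequences of an edge `u v` seen from a vertex `w`. -/
theorem near (hG : IsSwm G) {u v : V} (h : G.Adj u v) (w : V) :
    G.dist w u ≤ G.dist w v + 1 ∧ G.dist w v ≤ G.dist w u + 1 ∧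
      G.dist u w = G.dist w u ∧ G.dist v w = G.dist w v := by
  have h1 : G.dist u v = 1 := dist_eq_one_iff_adj.2 h
  have h2 := hG.connected.dist_triangle (u := w) (v := v) (w := u)
  have h3 := hG.connected.dist_triangle (u := w) (v := u) (w := v)
  rw [G.dist_comm (u := v) (v := u)] at h2
  exact ⟨by lia, by lia, dist_comm, dist_comm⟩

theorem tri (hG : IsSwm G) (u v w : V) : G.dist u w ≤ G.dist u v + G.dist v w ∧
    G.dist u v = G.dist v u ∧ G.dist v w = G.dist w v ∧ G.dist u w = G.dist w u :=
  ⟨hG.connected.dist_triangle, dist_comm, dist_comm, dist_comm⟩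

theorem eq_of_dist (hG : IsSwm G) {u v : V} (h : G.dist u v = 0) : u = v :=
  hG.connected.dist_eq_zero_iff.1 h

theorem dist_ne_zero (hG : IsSwm G) {u v : V} (h : u ≠ v) : G.dist u v ≠ 0 :=
  fun h' => h (hG.eq_of_dist h')

theorem dist_eq_two (hG : IsSwm G) {u v w : V} (hu : G.Adj w u) (hv : G.Adj w v)
    (hne : u ≠ v) (hadj : ¬ G.Adj u v) : G.dist u v = 2 := by
  have h1 := hG.connected.one_lt_dist_of_ne_of_not_adj hne hadj
  have h2 := hG.near hv u
  have h3 := hG.near hu u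
  have h4 : G.dist u u = 0 := dist_self
  lia

/-- Two common neighbours of adjacent vertices coincide or are adjacent. -/
theorem adj_of_common (hG : IsSwm G) {a b c d : V} (hab : G.Adj a b) (hac : G.Adj a c)
    (had : G.Adj a d) (hbc : G.Adj b c) (hbd : G.Adj b d) (hcd : c ≠ d) : G.Adj c d := by
  by_contra h
  exact hG.not_K4minus ⟨a, b, c, d, hab, hac, had, hbc, hbd, hcd, h⟩

theorem exists_triangle (hG : IsSwm G) {u v w : V} (h : G.Adj v w)
    (hd : G.dist u v = G.dist u w) :
    ∃ x, G.Adj v x ∧ G.Adj w x ∧ G.dist u x + 1 = G.dist u v := by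
  refine hG.triangle u v w h hd (Nat.one_le_iff_ne_zero.2 fun h0 => h.ne ?_)
  exact (hG.eq_of_dist h0).symm.trans (hG.eq_of_dist (hd ▸ h0))

theorem exists_quadrangle (hG : IsSwm G) {u v w z : V} (hv : G.Adj z v) (hw : G.Adj z w)
    (hne : v ≠ w) (hadj : ¬ G.Adj v w) (hd : G.dist u v = G.dist u w)
    (hz : G.dist u z = G.dist u v + 1) :
    ∃ x, G.Adj v x ∧ G.Adj w x ∧ G.dist u x + 1 = G.dist u v :=
  hG.quadrangle u v w z hv hw (hG.dist_eq_two hv hw hne hadj) hd hz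

/-- There are no edges inside a level of an interval. -/
theorem not_adj_of_level (hG : IsSwm G) {p q u v : V}
    (hu : G.dist p u + G.dist u q = G.dist p q) (hv : G.dist p v + G.dist v q = G.dist p q)
    (h : G.dist p u = G.dist p v) : ¬ G.Adj u v := by
  intro huv
  obtain ⟨z, hz1, hz2, hz⟩ := hG.exists_triangle huv h
  have h' : G.dist q u = G.dist q v := by
    have := hG.near huv q
    lia
  obtain ⟨w, hw1, hw2, hw⟩ := hG.exists_triangle huv h'
  have t1 := hG.tri p z q
  have t2 := hG.tri z w q
  have t3 := hG.near huv q
  have hzw : G.dist z w ≥ 2 := by lia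
  have hne : z ≠ w := by
    rintro rfl
    simp at hzw
  have := dist_eq_one_iff_adj.2 (hG.adj_of_common huv hz1 hw1 hz2 hw2 hne)
  lia

/-- In an interval, two vertices of a level have at most one common neighbour in the next
level. -/
theorem eq_of_square_level (hG : IsSwm G) {p q x y a b : V}
    (hxa : G.Adj x a) (hxb : G.Adj x b) (hya : G.Adj y a) (hyb : G.Adj y b)
    (hx : G.dist p x + G.dist x q = G.dist p q) (hy : G.dist p y + G.dist y q = G.dist p q)
    (ha : G.dist p a + G.dist a q = G.dist p q) (hb : G.dist p b + G.dist b q = G.dist p q)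
    (hxy : G.dist p x = G.dist p y) (hxa' : G.dist p a = G.dist p x + 1)
    (hab : G.dist p a = G.dist p b) (hne : x ≠ y) : a = b := by
  by_contra hne'
  have nxy := hG.not_adj_of_level hx hy hxy
  have nab := hG.not_adj_of_level ha hb hab
  have n1 := hG.near hxa q
  have n2 := hG.near hyb q
  obtain ⟨z, hz1, hz2, hz⟩ := hG.exists_quadrangle hxa.symm hya.symm hne nxy hxy hxa'
  obtain ⟨w, hw1, hw2, hw⟩ :=
    hG.exists_quadrangle (u := q) hxa hxb hne' nab (by lia) (by lia)
  have dself : ∀ v, G.dist v v = 0 := fun v => dist_self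
  have t1 := hG.tri p z q
  have t2 := hG.tri z w q
  have m1 := hG.near hz1 z
  have m2 := hG.near hxa z
  have m3 := hG.near hxb z
  have m4 := hG.near hw1 z
  have m5 := hG.near hw1 x
  have m6 := hG.near hxa x
  have m7 := hG.near hw1 y
  have m8 := hG.near hya y
  have s1 := dself z
  have s2 := dself x
  have s3 := dself y
  refine hG.not_K33minus ⟨a, b, z, x, y, w, hxa.symm, hya.symm, hw1, hxb.symm, hyb.symm, hw2,
    hz1.symm, hz2.symm, hG.dist_eq_two hxa hxb hne' nab, ?_, ?_,
    hG.dist_eq_two hxa.symm hya.symm hne nxy, ?_, ?_, ?_⟩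
  · have := hG.tri p z a
    lia
  · have := hG.tri p z b
    lia
  · have := hG.tri x w q
    lia
  · have := hG.tri y w q
    lia
  · lia

/-- A coatom of `I(p,q)` is never equidistant from `p` and from an atom. -/
theorem dist_atom_ne (hG : IsSwm G) {p q z c : V} (hz : G.Adj p z)
    (hzq : G.dist z q + 1 = G.dist p q) (hc : G.dist p c + G.dist c q = G.dist p q) :
    G.dist z c ≠ G.dist p c := by
  intro h
  have e1 := hG.near hz c
  obtain ⟨t, ht1, ht2, ht⟩ := hG.exists_triangle (u := c) hz (by lia)
  have e2 := hG.near ht1 q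
  have e3 := hG.near ht1 p
  have e4 := hG.near hz p
  have e5 := hG.near hz q
  have e6 := hG.tri t c q
  have s : G.dist p p = 0 := dist_self
  have e7 := hG.dist_ne_zero hz.ne
  have e8 := hG.dist_ne_zero ht1.ne
  exact hG.not_adj_of_level (p := p) (q := q) (u := z) (v := t) (by lia) (by lia)
    (by lia) ht2

/-- Complements can be moved upwards: if `c₁` is covered by the distinct coatoms `q₁`, `c` of
`I(p,q)` and the atom `z` lies below `q₁` but not below `c₁`, then it does not lie
below `c`. -/
theorem dist_coatom (hG : IsSwm G) {p q z q₁ c c₁ : V} {n : ℕ} (hpq : G.dist p q = n + 2)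
    (hz : G.Adj p z) (hzq : G.dist z q = n + 1) (hq₁ : G.Adj q₁ q) (hc : G.Adj c q)
    (hne : q₁ ≠ c) (hc₁q₁ : G.Adj c₁ q₁) (hc₁c : G.Adj c₁ c) (hpq₁ : G.dist p q₁ = n + 1)
    (hpc : G.dist p c = n + 1) (hzq₁ : G.dist z q₁ = n) (hzc₁ : G.dist z c₁ = n + 1)
    (hpc₁ : G.dist p c₁ = n) : G.dist z c = n + 2 := by
  have hcq : G.dist c q = 1 := dist_eq_one_iff_adj.2 hc
  have hq₁q : G.dist q₁ q = 1 := dist_eq_one_iff_adj.2 hq₁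
  have h1 := hG.dist_atom_ne (q := q) (c := c) hz (by lia) (by lia)
  have h2 := hG.near hz c
  by_contra h3
  have h4 : G.dist z c = n := by lia
  have nadj := hG.not_adj_of_level (p := p) (q := q) (u := q₁) (v := c) (by lia) (by lia)
    (by lia)
  obtain ⟨m, hm1, hm2, hm⟩ := hG.exists_quadrangle (u := z) hq₁.symm hc.symm hne nadj
    (by lia) (by lia)
  have e1 := hG.near hz m
  have e2 := hG.near hm1 q
  have e3 := hG.near hm1 p
  have e4 := hG.near hq₁ m
  have e5 := hG.near hc₁q₁ q
  have e6 := hG.near hq₁ p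
  have e7 := hG.tri p c₁ q
  have e8 := hG.tri p m q
  refine hne (hG.eq_of_square_level (p := p) (q := q) hm1.symm hm2.symm hc₁q₁ hc₁c
    (by lia) (by lia) (by lia) (by lia) (by lia) (by lia) (by lia) ?_)
  rintro rfl
  lia

theorem mem_interval_of_down (hG : IsSwm G) {p q u v : V} (h : G.Adj u v)
    (hu : G.dist p u + G.dist u q = G.dist p q) (hv : G.dist p v + 1 = G.dist p u) :
    G.dist p v + G.dist v q = G.dist p q := by
  have e1 := hG.near h q
  have e2 := hG.tri p v q
  lia

theorem mem_interval_of_up (hG : IsSwm G) {p q u v : V} (h : G.Adj u v)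
    (hu : G.dist p u + G.dist u q = G.dist p q) (hv : G.dist v q + 1 = G.dist u q) :
    G.dist p v + G.dist v q = G.dist p q := by
  have e1 := hG.near h p
  have e2 := hG.tri p v q
  lia

end IsSwm

/-- Two opposite edges `p a` and `b q` of a subgraph that looks metrically like the
product of an edge and an interval of length `n`. -/
structure Ladder (G : SimpleGraph V) (p a b q : V) (n : ℕ) : Prop where
  left : G.Adj p a
  right : G.Adj b q
  dist_pq : G.dist p q = n + 1
  dist_ab : G.dist a b = n + 1
  dist_pb : G.dist p b = n
  dist_aq : G.dist a q = n

/-- In the ladder `p a b q`, the vertex `v'` corresponds to the vertex `v` of `I(p,b)` under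
the perspectivity of `I(p,b)` and `I(a,q)`. -/
structure Parallel (G : SimpleGraph V) (p a q : V) (n : ℕ) (v v' : V) : Prop where
  adj : G.Adj v v'
  dist_left : G.dist a v' = G.dist p v
  dist_right : G.dist v' q + G.dist p v = n

section

variable {G : SimpleGraph V}

theorem Ladder.dist_right (hG : IsSwm G) {p a b q v : V} {n : ℕ} (h : Ladder G p a b q n)
    (hv : G.dist p v + G.dist v b = n) : G.dist p v + G.dist v q = n + 1 := by
  have e1 := hG.near h.right v
  have e2 := hG.tri p v q
  have e3 := h.dist_pq
  lia

theorem Ladder.dist_left (hG : IsSwm G) {p a b q v : V} {n : ℕ} (h : Ladder G p a b q n)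
    (hv : G.dist p v + G.dist v b = n) : G.dist a v = G.dist p v + 1 := by
  have e1 := hG.near h.left v
  have e2 := hG.tri a v b
  have e3 := h.dist_ab
  lia

theorem Ladder.dist_of_mem (hG : IsSwm G) {p a b q v : V} {n : ℕ} (h : Ladder G p a b q n)
    (hv : G.dist a v + G.dist v q = n) :
    G.dist p v = G.dist a v + 1 ∧ G.dist p v + G.dist v q = n + 1 := by
  have e1 := hG.near h.left v
  have e2 := hG.tri p v q
  have e3 := h.dist_pq
  lia

theorem Parallel.exists_next (hG : IsSwm G) {p a b q v v' u : V} {n : ℕ}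
    (h : Ladder G p a b q n) (hv : Parallel G p a q n v v')
    (hvb : G.dist p v + G.dist v b = n) (hub : G.dist p u + G.dist u b = n)
    (huv : G.Adj v u) (hu : G.dist p u = G.dist p v + 1) :
    ∃ u', G.Adj v' u' ∧ Parallel G p a q n u u' := by
  have vq := h.dist_right hG hvb
  have uq := h.dist_right hG hub
  have au := h.dist_left hG hub
  obtain ⟨h1, h2, h3⟩ := hv
  obtain ⟨pv', pv'q⟩ := h.dist_of_mem hG (v := v') (by lia)
  have hpq := h.dist_pq
  have hne : v' ≠ u := by
    rintro rfl
    lia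
  have nadj := hG.not_adj_of_level (p := p) (q := q) (u := v') (v := u) (by lia) (by lia)
    (by lia)
  have c1 := G.dist_comm (u := q) (v := v)
  have c2 := G.dist_comm (u := q) (v := v')
  have c3 := G.dist_comm (u := q) (v := u)
  obtain ⟨w, hw1, hw2, hw⟩ := hG.exists_quadrangle (u := q) h1 huv hne nadj (by lia) (by lia)
  have c4 := G.dist_comm (u := q) (v := w)
  have haq := h.dist_aq
  refine ⟨w, hw1, hw2, ?_, by lia⟩
  have := hG.near hw1 a
  have := hG.tri a w q
  lia

theorem Parallel.unique (hG : IsSwm G) {p a b q v v₁ v₂ : V} {n : ℕ}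
    (h : Ladder G p a b q n) (hv : G.dist p v + G.dist v b = n)
    (h₁ : Parallel G p a q n v v₁) (h₂ : Parallel G p a q n v v₂) : v₁ = v₂ := by
  have vq := h.dist_right hG hv
  have av := h.dist_left hG hv
  obtain ⟨a1, b1, c1⟩ := h₁
  obtain ⟨a2, b2, c2⟩ := h₂
  obtain ⟨pv1, pv1q⟩ := h.dist_of_mem hG (v := v₁) (by lia)
  obtain ⟨pv2, pv2q⟩ := h.dist_of_mem hG (v := v₂) (by lia)
  have hpq := h.dist_pq
  have haq := h.dist_aq
  by_contra hne
  have nadj := hG.not_adj_of_level (p := p) (q := q) (u := v₁) (v := v₂) (by lia) (by lia)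
    (by lia)
  have s1 := G.dist_comm (u := q) (v := v)
  have s2 := G.dist_comm (u := q) (v := v₁)
  have s3 := G.dist_comm (u := q) (v := v₂)
  obtain ⟨w, hw1, hw2, hw⟩ := hG.exists_quadrangle (u := q) a1 a2 hne nadj (by lia) (by lia)
  have aw : G.dist a w = G.dist a v₁ + 1 := by
    have := hG.mem_interval_of_up (p := a) (q := q) hw1 (by lia)
      (by rw [G.dist_comm (u := w)]; lia)
    rw [G.dist_comm (u := w)] at this
    lia
  obtain ⟨u, hu1, hu2, hu⟩ := hG.exists_quadrangle (u := a) hw1.symm hw2.symm hne nadj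
    (by lia) (by lia)
  have auq : G.dist a u + G.dist u q = n := by
    rw [hG.mem_interval_of_down hu1 (by lia) hu, haq]
  obtain ⟨pu, puq⟩ := h.dist_of_mem hG auq
  refine hne (hG.eq_of_square_level (p := p) (q := q) a1 a2 hu1.symm hu2.symm
    (by lia) (by lia) (by lia) (by lia) (by lia) (by lia) (by lia) ?_)
  rintro rfl
  lia

end

/-- The neighbour of `A` in the hypercube in direction `i`. -/
def flipAt {n : ℕ} (i : Fin n) (A : Fin n → Bool) : Fin n → Bool :=
  Function.update A i (!A i)

section flipAt

variable {n : ℕ}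

@[simp] theorem flipAt_self (i : Fin n) (A : Fin n → Bool) : flipAt i A i = !A i := by
  simp [flipAt]

@[simp] theorem flipAt_of_ne {i j : Fin n} (h : j ≠ i) (A : Fin n → Bool) :
    flipAt i A j = A j := by
  simp [flipAt, h]

@[simp] theorem flipAt_flipAt (i : Fin n) (A : Fin n → Bool) : flipAt i (flipAt i A) = A := by
  simp [flipAt]

theorem flipAt_comm {i j : Fin n} (h : i ≠ j) (A : Fin n → Bool) :
    flipAt i (flipAt j A) = flipAt j (flipAt i A) := by
  simp [flipAt, h, h.symm, Function.update_comm h]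

theorem hammingDist_flipAt_of_eq {i : Fin n} {A B : Fin n → Bool} (h : A i = B i) :
    hammingDist (flipAt i A) B = hammingDist A B + 1 := by
  unfold hammingDist
  rw [← Finset.card_insert_of_notMem (a := i) (by simp [h])]
  congr 1
  ext j
  by_cases hj : j = i
  · subst hj
    simp [h]
  · simp [hj]

theorem hammingDist_flipAt_of_ne {i : Fin n} {A B : Fin n → Bool} (h : A i ≠ B i) :
    hammingDist (flipAt i A) B + 1 = hammingDist A B := by
  have := hammingDist_flipAt_of_eq (i := i) (A := flipAt i A) (B := B)
    (by simp [Bool.eq_not_iff.2 h])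
  simpa using this.symm

@[simp] theorem hammingDist_flipAt_flipAt (i : Fin n) (A B : Fin n → Bool) :
    hammingDist (flipAt i A) (flipAt i B) = hammingDist A B := by
  by_cases h : A i = B i
  · have h1 := hammingDist_flipAt_of_eq h
    have h2 := hammingDist_flipAt_of_ne (i := i) (A := B) (B := flipAt i A) (by simp [h])
    rw [hammingDist_comm _ (flipAt i B), hammingDist_comm A B]
    rw [hammingDist_comm B, hammingDist_comm A B] at *
    lia
  · have h1 := hammingDist_flipAt_of_ne h
    have h2 := hammingDist_flipAt_of_eq (i := i) (A := B) (B := flipAt i A)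
      (by simp [Bool.eq_not_iff.2 h])
    rw [hammingDist_comm _ (flipAt i B)]
    rw [hammingDist_comm B] at h2
    lia

theorem exists_ne_of_hammingDist {A B : Fin n → Bool} (h : hammingDist A B ≠ 0) :
    ∃ i, A i ≠ B i :=
  Function.ne_iff.1 (hammingDist_ne_zero.1 h)

theorem hammingDist_not (A : Fin n → Bool) : hammingDist A (fun i => !A i) = n := by
  simp [hammingDist]

theorem hammingDist_add_not (A B : Fin n → Bool) :
    hammingDist A B + hammingDist B (fun i => !A i) = n := by
  have : ∀ i, B i ≠ (!A i) ↔ ¬ A i ≠ B i := fun i => by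
    cases A i <;> cases B i <;> simp
  simp only [hammingDist, this]
  rw [Finset.card_filter_add_card_filter_not]
  simp

end flipAt

/-- An isometric embedding of the `n`-cube. -/
def IsIsometricCube (G : SimpleGraph V) {n : ℕ} (F : (Fin n → Bool) → V) : Prop :=
  ∀ A B, G.dist (F A) (F B) = hammingDist A B

theorem IsIsometricCube.adj {G : SimpleGraph V} {n : ℕ} {F : (Fin n → Bool) → V}
    (hF : IsIsometricCube G F) (A : Fin n → Bool) (i : Fin n) :
    G.Adj (F A) (F (flipAt i A)) := by
  rw [← SimpleGraph.dist_eq_one_iff_adj, hF, hammingDist_comm, hammingDist_flipAt_of_eq rfl,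
    hammingDist_self]

/-- A homomorphic image of the `n`-cube in which no square degenerates. -/
structure IsLocalCube (G : SimpleGraph V) {n : ℕ} (F : (Fin n → Bool) → V) : Prop where
  adj : ∀ A i, G.Adj (F A) (F (flipAt i A))
  ne : ∀ A i j, i ≠ j → F (flipAt i (flipAt j A)) ≠ F A

namespace IsLocalCube

variable {G : SimpleGraph V} {n : ℕ} {F : (Fin n → Bool) → V}

theorem dist_le (hG : IsSwm G) (hF : IsLocalCube G F) (A B : Fin n → Bool) :
    G.dist (F A) (F B) ≤ hammingDist A B := by
  induction h : hammingDist A B generalizing A with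
  | zero => simp [eq_of_hammingDist_eq_zero h]
  | succ k ih =>
    obtain ⟨i, hi⟩ := exists_ne_of_hammingDist (A := A) (B := B) (by lia)
    have h1 := hammingDist_flipAt_of_ne hi
    have h2 := ih (flipAt i A) (by lia)
    have h3 := hG.near (hF.adj A i) (F B)
    lia

/-- Antipodality is transported along the edges of a local cube. -/
theorem dist_flipAt (hG : IsSwm G) (hF : IsLocalCube G F) {A B : Fin n → Bool}
    (h : G.dist (F A) (F B) = hammingDist A B) {i : Fin n} (hi : A i ≠ B i) :
    G.dist (F (flipAt i A)) (F (flipAt i B)) = hammingDist A B := by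
  induction hk : hammingDist A B generalizing A with
  | zero => exact absurd (congrFun (eq_of_hammingDist_eq_zero hk) i) hi
  | succ k ih =>
    have hiA := hammingDist_flipAt_of_ne hi
    obtain _ | k := k
    · have hA : flipAt i A = B := eq_of_hammingDist_eq_zero (by lia)
      rw [← hA, flipAt_flipAt, SimpleGraph.dist_comm, SimpleGraph.dist_eq_one_iff_adj]
      exact hF.adj A i
    · obtain ⟨j, hj⟩ := exists_ne_of_hammingDist (A := flipAt i A) (B := B) (by lia)
      have hji : j ≠ i := by
        rintro rfl
        simp [Bool.eq_not_iff.2 hi] at hj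
      rw [flipAt_of_ne hji] at hj
      have hjA := hammingDist_flipAt_of_ne hj
      have hdj : G.dist (F (flipAt j A)) (F B) = hammingDist (flipAt j A) B := by
        have := hF.dist_le hG (flipAt j A) B
        have := hG.near (hF.adj A j) (F B)
        lia
      have hij : (flipAt j A) i ≠ B i := by rwa [flipAt_of_ne hji.symm]
      have key := ih hdj hij (by lia)
      have hijA := hammingDist_flipAt_of_ne hij
      rw [SimpleGraph.dist_comm]
      have ubc : hammingDist B (flipAt i A) = k + 1 := by
        rw [hammingDist_comm]
        lia
      have uzq : hammingDist (flipAt i B) A = k + 1 := by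
        have := hammingDist_flipAt_of_ne hi.symm
        rw [hammingDist_comm B] at this
        lia
      have uzq₁ : hammingDist (flipAt i B) (flipAt j A) = k := by
        have := hammingDist_flipAt_of_ne hij.symm
        rw [hammingDist_comm B] at this
        lia
      have b1 := hF.dist_le hG B (flipAt i A)
      have b2 := hF.dist_le hG (flipAt i B) A
      have b3 := hF.dist_le hG (flipAt i B) (flipAt j A)
      have b4 := hF.dist_le hG B (flipAt i (flipAt j A))
      rw [hammingDist_comm] at b4
      have n1 := hG.near (hF.adj A i) (F B)
      have n2 := hG.near (hF.adj A j) (F B)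
      have n3 := hG.near (hF.adj B i) (F A)
      have n4 := hG.near (hF.adj B i) (F (flipAt j A))
      have n5 := hG.near (hF.adj (flipAt j A) i) (F B)
      refine hG.dist_coatom (p := F B) (q := F A) (q₁ := F (flipAt j A))
        (c₁ := F (flipAt i (flipAt j A))) (by lia) (hF.adj B i) (by lia) (hF.adj A j).symm
        (hF.adj A i).symm ?_ (hF.adj _ i).symm ?_ (by lia) (by lia) (by lia) ?_ (by lia)
      · have := hF.ne (flipAt j A) i j hji.symm
        rw [flipAt_flipAt] at this
        exact this.symm
      · rw [flipAt_comm hji.symm]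
        exact (hF.adj _ j).symm
      · rw [SimpleGraph.dist_comm, key]

theorem isIsometricCube (hG : IsSwm G) (hF : IsLocalCube G F) {A : Fin n → Bool}
    (hA : G.dist (F A) (F fun i => !A i) = n) : IsIsometricCube G F := by
  have anti (B : Fin n → Bool) : G.dist (F B) (F fun i => !B i) = n := by
    induction h : hammingDist B A generalizing B with
    | zero => rwa [eq_of_hammingDist_eq_zero h]
    | succ k ih =>
      obtain ⟨i, hi⟩ := exists_ne_of_hammingDist (A := B) (B := A) (by lia)
      have h1 := ih (flipAt i B) (by have := hammingDist_flipAt_of_ne hi; lia)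
      have h2 := hF.dist_flipAt hG (i := i) (by rw [h1, hammingDist_not]) (by simp)
      rw [hammingDist_not, flipAt_flipAt] at h2
      convert h2 using 3
      funext j
      by_cases hj : j = i
      · subst hj
        simp
      · simp [hj]
  intro B C
  have h1 := hF.dist_le hG B C
  have h2 := hF.dist_le hG C (fun i => !B i)
  have h3 := hG.tri (F B) (F C) (F fun i => !B i)
  have h4 := hammingDist_add_not B C
  have h5 := anti B
  lia

end IsLocalCube

/-- `p` and `q` both lie on some isometric cube. -/
def CubePair (G : SimpleGraph V) (p q : V) : Prop :=
  ∃ (n : ℕ) (F : (Fin n → Bool) → V), IsIsometricCube G F ∧ ∃ A B, F A = p ∧ F B = q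

/-- `p` and `q` are antipodal on some isometric `n`-cube. -/
def AntipodalPair (G : SimpleGraph V) (n : ℕ) (p q : V) : Prop :=
  ∃ F : (Fin n → Bool) → V, IsIsometricCube G F ∧ F (fun _ => false) = p ∧
    F (fun _ => true) = q

namespace CubePair

variable {G : SimpleGraph V}

theorem symm {p q : V} (h : CubePair G p q) : CubePair G q p := by
  obtain ⟨n, F, hF, A, B, hA, hB⟩ := h
  exact ⟨n, F, hF, B, A, hB, hA⟩

theorem exists_ladder {p q : V} (h : CubePair G p q) {n : ℕ} (hn : G.dist p q = n + 1) :
    ∃ a b, Ladder G p a b q n ∧ CubePair G p b ∧ CubePair G a q := by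
  obtain ⟨m, F, hF, A, B, rfl, rfl⟩ := h
  have hAB := hF A B
  obtain ⟨i, hi⟩ := exists_ne_of_hammingDist (A := A) (B := B) (by lia)
  have h1 := hammingDist_flipAt_of_ne hi
  have h2 := hammingDist_flipAt_of_ne hi.symm
  refine ⟨F (flipAt i A), F (flipAt i B), ⟨hF.adj A i, (hF.adj B i).symm, hn, ?_, ?_, ?_⟩,
    ⟨m, F, hF, _, _, rfl, rfl⟩, ⟨m, F, hF, _, _, rfl, rfl⟩⟩
  · rw [hF, hammingDist_flipAt_flipAt]
    lia
  · rw [SimpleGraph.dist_comm, hF]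
    rw [hammingDist_comm B] at h2
    lia
  · rw [hF]
    lia

end CubePair

@[simp] theorem tail_flipAt_zero {n : ℕ} (A : Fin (n + 1) → Bool) :
    Fin.tail (flipAt 0 A) = Fin.tail A := by
  funext j
  simp [Fin.tail]

@[simp] theorem tail_flipAt_succ {n : ℕ} (i : Fin n) (A : Fin (n + 1) → Bool) :
    Fin.tail (flipAt i.succ A) = flipAt i (Fin.tail A) := by
  funext j
  by_cases hj : j = i
  · subst hj
    simp [Fin.tail]
  · simp [Fin.tail, hj]

section

variable {G : SimpleGraph V}

/-- The cube on `I(p,b)` is transported along a ladder to a parallel cube. -/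
theorem Ladder.exists_parallel (hG : IsSwm G) {p a b q : V} {n : ℕ} (h : Ladder G p a b q n)
    {F : (Fin n → Bool) → V} (hF : IsIsometricCube G F) (hp : F (fun _ => false) = p)
    (hb : F (fun _ => true) = b) :
    ∃ g : (Fin n → Bool) → V, (∀ A, Parallel G p a q n (F A) (g A)) ∧
      ∀ A i, G.Adj (g A) (g (flipAt i A)) := by
  have hpF (A) : G.dist p (F A) = hammingDist (fun _ => false) A := by rw [← hp, hF]
  have hFb (A) : G.dist p (F A) + G.dist (F A) b = n := by
    rw [← hp, ← hb, hF, hF]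
    exact hammingDist_add_not (fun _ => false) A
  have up (A) (i) (hi : A i = false) : G.dist p (F (flipAt i A)) = G.dist p (F A) + 1 := by
    rw [hpF, hpF, hammingDist_comm, hammingDist_flipAt_of_eq hi, hammingDist_comm]
  have ex (A) : ∃ v, Parallel G p a q n (F A) v := by
    induction hk : hammingDist A (fun _ => false) generalizing A with
    | zero =>
      have hA := eq_of_hammingDist_eq_zero hk
      refine ⟨a, ?_, ?_, ?_⟩
      · rw [hA, hp]
        exact h.left
      · simp [hA, hp]
      · simp [hA, hp, h.dist_aq]
    | succ k ih =>
      obtain ⟨i, hi⟩ := exists_ne_of_hammingDist (A := A) (B := fun _ => false) (by lia)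
      have h1 := hammingDist_flipAt_of_ne (B := fun _ => false) hi
      obtain ⟨v, hv⟩ := ih (flipAt i A) (by lia)
      have h2 := up (flipAt i A) i (by simpa using hi)
      have h3 := hF.adj (flipAt i A) i
      rw [flipAt_flipAt] at h2 h3
      obtain ⟨w, -, hw⟩ := hv.exists_next hG h (hFb _) (hFb _) h3 h2
      exact ⟨w, hw⟩
  choose g hg using ex
  have adj (A) (i) (hi : A i = false) : G.Adj (g A) (g (flipAt i A)) := by
    obtain ⟨w, hw, hw'⟩ := (hg A).exists_next hG h (hFb _) (hFb _) (hF.adj A i) (up A i hi)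
    rwa [(hg (flipAt i A)).unique hG h (hFb _) hw']
  refine ⟨g, hg, fun A i => ?_⟩
  cases hi : A i with
  | false => exact adj A i hi
  | true =>
    have := adj (flipAt i A) i (by simp [hi])
    rw [flipAt_flipAt] at this
    exact this.symm

theorem Ladder.exists_isIsometricCube (hG : IsSwm G) {p a b q : V} {n : ℕ}
    (h : Ladder G p a b q n) (hpb : AntipodalPair G n p b) :
    AntipodalPair G (n + 1) p q ∧ CubePair G a q := by
  obtain ⟨F, hF, hp, hb⟩ := hpb
  obtain ⟨g, hg, hgadj⟩ := h.exists_parallel hG hF hp hb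
  have hFb (A) : G.dist p (F A) + G.dist (F A) b = n := by
    rw [← hp, ← hb, hF, hF]
    exact hammingDist_add_not (fun _ => false) A
  have hpF (A) : G.dist p (F A) = hammingDist A (fun _ => false) := by
    rw [← hp, hF, hammingDist_comm]
  have hpg (A) : G.dist p (g A) = G.dist p (F A) + 1 ∧ G.dist p (g A) + G.dist (g A) q = n + 1 := by
    have h1 := (hg A).dist_left
    have h2 := (hg A).dist_right
    have h3 := h.dist_of_mem hG (v := g A) (by lia)
    lia
  have gF (A B) : g A ≠ F B := by
    intro hAB
    have h1 := (hg A).dist_left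
    have h2 := h.dist_left hG (hFb B)
    have h3 := hpg A
    rw [hAB] at h1 h3
    lia
  have Fne (A) (i j : Fin n) (hij : i ≠ j) : F (flipAt i (flipAt j A)) ≠ F A := by
    intro hAB
    have h1 := hF (flipAt i (flipAt j A)) A
    rw [hAB, hammingDist_flipAt_of_eq (by simp [hij]), hammingDist_flipAt_of_eq rfl] at h1
    simp at h1
  have gne' (A) (i j : Fin n) (hij : i ≠ j) (hi : A i = false) :
      g (flipAt i (flipAt j A)) ≠ g A := by
    intro hAB
    have h1 := (hg A).dist_left
    have h2 := (hg (flipAt i (flipAt j A))).dist_left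
    have hup : G.dist p (F (flipAt i A)) = G.dist p (F A) + 1 := by
      rw [hpF, hpF, hammingDist_flipAt_of_eq hi]
    have hlev : G.dist p (F (flipAt i (flipAt j A))) = G.dist p (F A) := by
      rw [← h1, ← h2, hAB]
    have hadj := hF.adj (flipAt i A) j
    rw [flipAt_comm hij.symm] at hadj
    have hadj' := (hg (flipAt i (flipAt j A))).adj
    rw [hAB] at hadj'
    have m1 := h.dist_right hG (hFb A)
    have m2 := h.dist_right hG (hFb (flipAt i A))
    have m3 := h.dist_right hG (hFb (flipAt i (flipAt j A)))
    have m4 := hpg A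
    have hpq := h.dist_pq
    exact gF A (flipAt i A) (hG.eq_of_square_level (p := p) (q := q) (hg A).adj (hF.adj A i)
      hadj' hadj.symm (by lia) (by lia) (by lia) (by lia) (by lia) (by lia) (by lia)
      (Fne A i j hij).symm)
  have gne (A) (i j : Fin n) (hij : i ≠ j) : g (flipAt i (flipAt j A)) ≠ g A := by
    cases hi : A i with
    | false => exact gne' A i j hij hi
    | true =>
      have := gne' (flipAt i (flipAt j A)) i j hij (by simp [hij, hi])
      rw [flipAt_comm hij.symm, flipAt_flipAt, flipAt_flipAt] at this
      exact this.symm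
  let F' : (Fin (n + 1) → Bool) → V := fun A => if A 0 then g (Fin.tail A) else F (Fin.tail A)
  have hF' : IsLocalCube G F' := by
    constructor
    · intro A i
      refine Fin.cases ?_ (fun i => ?_) i
      · cases hA : A 0
        · simpa [F', hA] using (hg (Fin.tail A)).adj
        · simpa [F', hA] using (hg (Fin.tail A)).adj.symm
      · cases hA : A 0
        · simpa [F', hA, (Fin.succ_ne_zero i).symm] using hF.adj (Fin.tail A) i
        · simpa [F', hA, (Fin.succ_ne_zero i).symm] using hgadj (Fin.tail A) i
    · intro A i j hij
      have hs (i : Fin n) : (0 : Fin (n + 1)) ≠ i.succ := (Fin.succ_ne_zero i).symm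
      induction i using Fin.cases <;> induction j using Fin.cases <;> cases hA : A 0
      · exact absurd rfl hij
      · exact absurd rfl hij
      · simpa [F', hA, hs] using gF _ _
      · simpa [F', hA, hs] using (gF _ _).symm
      · simpa [F', hA, hs] using gF _ _
      · simpa [F', hA, hs] using (gF _ _).symm
      · simpa [F', hA, hs] using Fne _ _ _ (fun h => hij (congrArg _ h))
      · simpa [F', hA, hs] using gne _ _ _ (fun h => hij (congrArg _ h))
  have hp' : F' (fun _ => false) = p := by
    rw [← hp]
    rfl
  have hq' : F' (fun _ => true) = q := by
    have h1 := (hg (fun _ => true)).dist_right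
    have h2 := hFb (fun _ => true)
    have h3 : G.dist b b = 0 := SimpleGraph.dist_self
    rw [hb] at h1 h2
    exact hG.eq_of_dist (u := g (fun _ => true)) (by lia)
  have iso := hF'.isIsometricCube hG (A := fun _ => false) (by
    change G.dist (F' fun _ => false) (F' fun _ => true) = _
    rw [hp', hq', h.dist_pq])
  refine ⟨⟨F', iso, hp', hq'⟩, n + 1, F', iso, flipAt 0 (fun _ => false), fun _ => true, ?_, hq'⟩
  have h1 := (hg (fun _ => false)).dist_left
  have h3 : G.dist p p = 0 := SimpleGraph.dist_self
  rw [hp] at h1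
  rw [hG.eq_of_dist (u := a) (h1.trans h3)]
  simp only [F', flipAt_self, tail_flipAt_zero]
  rfl

theorem CubePair.antipodalPair (hG : IsSwm G) {p q : V} (h : CubePair G p q) :
    AntipodalPair G (G.dist p q) p q := by
  induction hn : G.dist p q generalizing q with
  | zero =>
    exact ⟨fun _ => p, fun A B => by simp [Subsingleton.elim A B], rfl, hG.eq_of_dist hn⟩
  | succ n ih =>
    obtain ⟨a, b, hl, hpb, -⟩ := h.exists_ladder hn
    exact (hl.exists_isIsometricCube hG (ih hpb hl.dist_pb)).1

theorem AntipodalPair.cubePair {n : ℕ} {p q : V} (h : AntipodalPair G n p q) :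
    CubePair G p q := by
  obtain ⟨F, hF, hp, hq⟩ := h
  exact ⟨n, F, hF, _, _, hp, hq⟩

theorem Ladder.cubePair (hG : IsSwm G) {p a b q : V} {n : ℕ} (h : Ladder G p a b q n)
    (hpb : CubePair G p b) : CubePair G p q ∧ CubePair G a q := by
  have h1 := hpb.antipodalPair hG
  rw [h.dist_pb] at h1
  obtain ⟨h2, h3⟩ := h.exists_isIsometricCube hG h1
  exact ⟨h2.cubePair, h3⟩

end

section

variable {G : SimpleGraph V}

theorem Ladder.symm {p a b q : V} {n : ℕ} (h : Ladder G p a b q n) : Ladder G q b a p n where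
  left := h.right.symm
  right := h.left.symm
  dist_pq := by rw [SimpleGraph.dist_comm, h.dist_pq]
  dist_ab := by rw [SimpleGraph.dist_comm, h.dist_ab]
  dist_pb := by rw [SimpleGraph.dist_comm, h.dist_aq]
  dist_aq := by rw [SimpleGraph.dist_comm, h.dist_pb]

theorem IsSwm.exists_adj_closer (hG : IsSwm G) {p v : V} {n : ℕ} (h : G.dist p v = n + 1) :
    ∃ w, G.Adj p w ∧ G.dist w v = n := by
  obtain ⟨W, hW⟩ := hG.connected.exists_walk_length_eq_dist p v
  cases W with
  | nil => simp at h
  | cons hadj W =>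
    rename_i w
    refine ⟨w, hadj, ?_⟩
    have h1 := SimpleGraph.dist_le W
    have h2 := hG.near hadj v
    rw [SimpleGraph.Walk.length_cons] at hW
    lia

/-- The hypercube of a Boolean pair is antipodal with respect to the two vertices. -/
theorem BooleanPair.cubePair (hG : IsSwm G) {p q : V} (h : BooleanPair G p q) :
    CubePair G p q := by
  obtain ⟨F, hI, hF⟩ := h
  have hF : IsIsometricCube G F := hF
  have hI (A) : G.dist p (F A) + G.dist (F A) q = G.dist p q := hI A
  obtain ⟨A, hA⟩ := Finite.exists_min fun A => G.dist p (F A)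
  have step (C) (i) : G.dist p (F (flipAt i C)) = G.dist p (F C) + 1 ∨
      G.dist p (F (flipAt i C)) + 1 = G.dist p (F C) := by
    have h1 := hG.near (hF.adj C i) p
    have h2 : G.dist p (F C) ≠ G.dist p (F (flipAt i C)) :=
      fun h => hG.not_adj_of_level (hI _) (hI _) h (hF.adj C i)
    lia
  have level (k : ℕ) (B) (hB : hammingDist B A = k) :
      G.dist p (F B) = G.dist p (F A) + k := by
    induction k using Nat.strong_induction_on generalizing B with
    | _ k ih =>
    obtain _ | _ | k := k
    · simp [eq_of_hammingDist_eq_zero hB]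
    · obtain ⟨i, hi⟩ := exists_ne_of_hammingDist (A := B) (B := A) (by lia)
      have hi' := hammingDist_flipAt_of_ne hi
      have hiA : flipAt i B = A := eq_of_hammingDist_eq_zero (by lia)
      have h1 := step B i
      have h2 := hA B
      rw [hiA] at h1
      lia
    · obtain ⟨i, hi⟩ := exists_ne_of_hammingDist (A := B) (B := A) (by lia)
      have hi' := hammingDist_flipAt_of_ne hi
      obtain ⟨j, hj⟩ := exists_ne_of_hammingDist (A := flipAt i B) (B := A) (by lia)
      have hji : j ≠ i := by
        rintro rfl
        simp [Bool.eq_not_iff.2 hi] at hj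
      have hij' := hammingDist_flipAt_of_ne hj
      rw [flipAt_of_ne hji] at hj
      have hj' := hammingDist_flipAt_of_ne hj
      have l1 := ih (k + 1) (by lia) (flipAt i B) (by lia)
      have l2 := ih (k + 1) (by lia) (flipAt j B) (by lia)
      have l3 := ih k (by lia) (flipAt j (flipAt i B)) (by lia)
      have h1 := step B i
      by_contra hne
      have a1 := hF.adj (flipAt i B) j
      have a2 := hF.adj (flipAt j B) i
      rw [flipAt_comm hji.symm] at a2
      have hEq := hG.eq_of_square_level (hF.adj B i) (hF.adj B j) a1.symm a2.symm (hI _) (hI _)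
        (hI _) (hI _) (by lia) (by lia) (by lia) ?_
      · have := hF (flipAt i B) (flipAt j B)
        rw [hEq, SimpleGraph.dist_self, hammingDist_flipAt_of_eq (by simp [hji.symm])] at this
        rw [hammingDist_comm, hammingDist_flipAt_of_eq rfl] at this
        lia
      · intro hEq
        have := hF B (flipAt j (flipAt i B))
        rw [← hEq, SimpleGraph.dist_self, hammingDist_comm,
          hammingDist_flipAt_of_eq (by simp [hji]), hammingDist_flipAt_of_eq rfl] at this
        lia
  have h1 := level _ (fun i => !A i) (by rw [hammingDist_comm, hammingDist_not])
  have h2 := hI fun i => !A i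
  exact ⟨_, F, hF, A, fun i => !A i, (hG.eq_of_dist (by lia)).symm, hG.eq_of_dist (by lia)⟩

theorem CubePair.booleanPair (hG : IsSwm G) {p q : V} (h : CubePair G p q) :
    BooleanPair G p q := by
  obtain ⟨F, hF, hp, hq⟩ := h.antipodalPair hG
  refine ⟨F, fun A => ?_, hF⟩
  have h1 := hammingDist_add_not (fun _ => false) A
  rw [← hF, ← hF, hp] at h1
  simp only [Bool.not_false] at h1
  rwa [hq] at h1

namespace CubePair

theorem of_adj {p q : V} (h : G.Adj p q) : CubePair G p q := by
  refine ⟨1, fun A => if A 0 then q else p, fun A B => ?_, fun _ => false, fun _ => true, rfl, rfl⟩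
  have h1 := SimpleGraph.dist_eq_one_iff_adj.2 h
  have h2 := SimpleGraph.dist_eq_one_iff_adj.2 h.symm
  cases hA : A 0 <;> cases hB : B 0 <;> simp [hammingDist, hA, hB, h1, h2, Finset.filter_singleton]

theorem of_atom (hG : IsSwm G) {p q v : V} (h : CubePair G p q) (hv : G.Adj p v)
    (hvq : G.dist v q + 1 = G.dist p q) : CubePair G v q := by
  induction hn : G.dist p q generalizing q with
  | zero => lia
  | succ n ih =>
    obtain ⟨a, b, hl, hpb, haq⟩ := h.exists_ladder hn
    have hbq := SimpleGraph.dist_eq_one_iff_adj.2 hl.right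
    have h1 := hl.dist_pb
    have h2 := hG.dist_atom_ne (c := b) hv hvq (by lia)
    have h3 := hG.near hv b
    by_cases h4 : G.dist v b = n + 1
    · exact (Ladder.cubePair hG ⟨hv, hl.right, hn, h4, h1, by lia⟩ hpb).2
    · obtain ⟨m, rfl⟩ : ∃ m, n = m + 1 := ⟨n - 1, by lia⟩
      have hvb : CubePair G v b := ih hpb (by lia) h1
      have hpv := SimpleGraph.dist_eq_one_iff_adj.2 hv
      have hpp : G.dist p p = 0 := SimpleGraph.dist_self
      have haa : G.dist a a = 0 := SimpleGraph.dist_self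
      have haq := hl.dist_aq
      obtain ⟨v', hv', hpar⟩ := Parallel.exists_next hG hl (v := p) (v' := a) (u := v)
        ⟨hl.left, by lia, by lia⟩ (by lia) (by lia) hv (by lia)
      have e1 := hpar.dist_right
      have e2 := hpar.dist_left
      have e3 := hl.dist_ab
      have e4 := hG.tri a v' b
      have e5 := hG.near hpar.adj b
      exact (Ladder.cubePair hG (p := v) (a := v') (b := b) (q := q) (n := m)
        ⟨hpar.adj, hl.right, by lia, by lia, by lia, by lia⟩ hvb).1

theorem of_mem (hG : IsSwm G) {p q v : V} (h : CubePair G p q)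
    (hv : G.dist p v + G.dist v q = G.dist p q) : CubePair G v q := by
  induction hk : G.dist p v generalizing p with
  | zero => rwa [← hG.eq_of_dist hk]
  | succ k ih =>
    obtain ⟨w, hw, hwv⟩ := hG.exists_adj_closer hk
    have h1 := hG.near hw q
    have h2 := hG.tri w v q
    exact ih (h.of_atom hG hw (by lia)) (by lia) hwv

theorem of_mem_left (hG : IsSwm G) {p q v : V} (h : CubePair G p q)
    (hv : G.dist p v + G.dist v q = G.dist p q) : CubePair G p v := by
  refine (h.symm.of_mem hG ?_).symm
  have := hG.tri p v q
  lia

theorem exists_other {p q : V} (h : CubePair G p q) (hd : G.dist p q = 2) (m : V) :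
    ∃ w, w ≠ m ∧ G.Adj p w ∧ G.Adj w q := by
  obtain ⟨a, b, hl, -, -⟩ := h.exists_ladder hd
  by_cases ha : a = m
  · refine ⟨b, ?_, SimpleGraph.dist_eq_one_iff_adj.1 hl.dist_pb, hl.right⟩
    rintro rfl
    have := hl.dist_ab
    simp [ha] at this
  · exact ⟨a, ha, hl.left, SimpleGraph.dist_eq_one_iff_adj.1 hl.dist_aq⟩

/-- Atoms of the interval of a cube pair have complements. -/
theorem exists_complement (hG : IsSwm G) {p q z : V} {n : ℕ} (h : CubePair G p q)
    (hn : G.dist p q = n + 1) (hz : G.Adj p z) (hzq : G.dist z q = n) :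
    ∃ c, Ladder G p z c q n := by
  induction n generalizing q with
  | zero =>
    obtain rfl := hG.eq_of_dist hzq
    exact ⟨p, hz, hz, by lia, by rw [SimpleGraph.dist_comm]; lia, SimpleGraph.dist_self,
      SimpleGraph.dist_self⟩
  | succ n ih =>
    obtain ⟨q₁, hq₁, hq₁z⟩ := hG.exists_adj_closer (p := q) (v := z) (n := n)
      (by rw [SimpleGraph.dist_comm, hzq])
    have e1 := hG.near hq₁ p
    have e2 := hG.near hz q₁
    have e3 := SimpleGraph.dist_eq_one_iff_adj.2 hq₁.symm
    obtain ⟨c₁, hc₁⟩ := ih (q := q₁) (h.of_mem_left hG (by lia)) (by lia) (by lia)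
    have e4 := hc₁.dist_pb
    have e5 := hG.near hc₁.right q
    have e6 := hG.tri p c₁ q
    have e7 : G.dist c₁ q = 2 := by lia
    obtain ⟨c, hc, hc₁c, hcq⟩ := (h.of_mem hG (v := c₁) (by lia)).exists_other e7 q₁
    have e8 := hG.near hcq p
    have e9 := hG.near hc₁c p
    refine ⟨c, hz, hcq, hn, ?_, by lia, hzq⟩
    exact hG.dist_coatom hn hz hzq hq₁.symm hcq hc.symm hc₁.right hc₁c (by lia) (by lia)
      (by lia) hc₁.dist_ab e4

end CubePair

end

section

variable {G : SimpleGraph V}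

theorem CubePair.of_equidistant (hG : IsSwm G) {a x y : V} (h : CubePair G a y)
    (hxa : G.Adj x a) (hd : G.dist x y = G.dist a y) : CubePair G x y := by
  obtain ⟨z, hxz, haz, hz⟩ := hG.exists_triangle (u := y) hxa (by
    rw [SimpleGraph.dist_comm, hd, SimpleGraph.dist_comm])
  have ez := hG.near haz y
  have ex := G.dist_comm (u := y) (v := x)
  obtain ⟨c, hc⟩ := h.exists_complement hG (z := z) (n := G.dist y z) (by lia) haz (by lia)
  generalize hn : G.dist y z = n at hc hz
  have c1 := hc.dist_ab
  have c2 := hc.dist_pb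
  have c3 := hc.dist_pq
  have c4 := hc.dist_aq
  have xc : G.dist x c = n + 1 := by
    by_contra hne
    have e1 := hG.near hxz c
    have e2 := hG.near hxa c
    obtain ⟨t, hxt, hat, ht⟩ := hG.exists_triangle (u := c) hxa (by lia)
    have hzt : z ≠ t := by
      rintro rfl
      lia
    have e3 := hG.near (hG.adj_of_common hxa hxz hxt haz hat hzt) c
    lia
  obtain ⟨c', hcc', hyc', hc'⟩ := hG.exists_triangle (u := x) hc.right (by lia)
  have zc' : G.dist z c' = n + 1 := by
    by_contra hne
    have e1 := hG.near hcc' z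
    have e2 := hG.near hyc' z
    have e3 := G.dist_comm (u := y) (v := z)
    obtain ⟨t, hyt, hct, ht⟩ := hG.exists_triangle (u := z) hyc' (by lia)
    have e4 := hG.near hct z
    have hct' : c ≠ t := by
      rintro rfl
      lia
    have e5 := hG.near (hG.adj_of_common hyc' hc.right.symm hyt hcc'.symm hct hct') z
    lia
  have hl : Ladder G x z c' y n := ⟨hxz, hyc'.symm, by lia, zc', by lia, c4⟩
  exact (hl.symm.cubePair hG (h.of_atom hG haz (by lia)).symm).1.symm

/-- If an edge `x a` separates `y` from `b` and `y`, `b` span a cube, then some edge at `y` is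
opposite to the edge `x a` in a ladder. -/
theorem CubePair.exists_opposite (hG : IsSwm G) {x a y b : V} (h : CubePair G y b)
    (hxa : G.Adj x a) (hy : G.dist x y = G.dist a y + 1) (hb : G.dist a b = G.dist x b + 1) :
    ∃ c, G.Adj c y ∧ G.dist x c = G.dist a y ∧ G.dist a c = G.dist a y + 1 ∧
      G.dist c b ≤ G.dist y b := by
  induction hr : G.dist y b generalizing y with
  | zero =>
    obtain rfl := hG.eq_of_dist hr
    lia
  | succ r ih =>
    obtain ⟨v, hyv, hvb⟩ := hG.exists_adj_closer hr
    have hax : G.dist a x = 1 := SimpleGraph.dist_eq_one_iff_adj.2 hxa.symm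
    generalize hD : G.dist a y = D at *
    have good {w : V} (hyw : G.Adj y w) (hw : G.dist x w = D) : G.dist a w ≠ D := by
      have e1 := hG.dist_atom_ne (p := y) (q := x) (z := w) (c := a) hyw
        (by rw [G.dist_comm (u := w), G.dist_comm (u := y)]; lia)
        (by rw [G.dist_comm (u := y), G.dist_comm (u := y)]; lia)
      rwa [G.dist_comm (u := w), G.dist_comm (u := y), hD] at e1
    have ev1 := hG.near hyv a
    have ev2 := hG.near hyv x
    have ev3 := hG.near hxa v
    by_cases h1 : G.dist a v = G.dist x v + 1
    · exact ⟨v, hyv.symm, by lia, by lia, by lia⟩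
    by_cases h2 : G.dist x v = G.dist a v
    · have h3 : G.dist x v ≠ D := fun h3 => good hyv h3 (by lia)
      obtain ⟨t, hyt, hvt, ht⟩ := hG.exists_triangle (u := x) hyv (by lia)
      have h4 := good hyt (by lia)
      have h5 := hG.near hvt a
      have h6 := hG.near hyt a
      have h7 := hG.near hvt b
      exact ⟨t, hyt.symm, by lia, by lia, by lia⟩
    have h3 : G.dist x v = G.dist a v + 1 := by lia
    obtain ⟨c, hcv, hxc, hac, hcb⟩ := ih (h.of_atom hG hyv (by lia)) h3 hvb
    have finish {w : V} (hyw : G.Adj y w) (hcw : G.Adj c w) (hxw : G.dist x w = D)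
        (haw : G.dist a w = D + 1) : ∃ c, G.Adj c y ∧ G.dist x c = D ∧ G.dist a c = D + 1 ∧
          G.dist c b ≤ r + 1 := by
      have := hG.near hcw b
      exact ⟨w, hyw.symm, hxw, haw, by lia⟩
    obtain hv | hv | hv : G.dist a v = D + 1 ∨ G.dist a v + 1 = D ∨ G.dist a v = D := by lia
    · have hyc : y ≠ c := by
        rintro rfl
        lia
      have hnadj : ¬ G.Adj y c := fun hadj => by
        have := hG.near hadj a
        lia
      obtain ⟨w, hyw, hcw, hw⟩ :=
        hG.exists_quadrangle (u := x) hyv.symm hcv.symm hyc hnadj (by lia) (by lia)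
      have := hG.near hyw a
      have := hG.near hcw a
      exact finish hyw hcw (by lia) (by lia)
    · have hxy := hG.tri x c y
      have hyc : G.dist y c = 2 := by
        have := hG.near hcv y
        have := SimpleGraph.dist_eq_one_iff_adj.2 hyv
        lia
      have hcube : CubePair G y c := by
        have e1 := hG.near hcv b
        by_cases e2 : G.dist c b = r
        · obtain ⟨t, hct, hvt, ht⟩ := hG.exists_triangle (u := b) hcv (by lia)
          have e3 := hG.near hvt y
          have e4 := SimpleGraph.dist_eq_one_iff_adj.2 hyv
          have e5 := hG.tri y t b
          have e6 : CubePair G y t := h.of_mem_left hG (by lia)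
          exact (e6.symm.of_equidistant hG hct (by
            rw [SimpleGraph.dist_comm, G.dist_comm (u := t)]
            lia)).symm
        · have e3 := hG.tri y c b
          exact h.of_mem_left hG (by lia)
      obtain ⟨w, hwv, hyw, hwc⟩ := hcube.exists_other hyc v
      have w1 := hG.near hyw x
      have w2 := hG.near hwc x
      have hxw : G.dist x w = D := by lia
      have w3 := good hyw hxw
      have w4 := hG.near hyw a
      refine finish hyw hwc.symm hxw ?_
      by_contra w5
      have yv := SimpleGraph.dist_eq_one_iff_adj.2 hyv.symm
      have yw := SimpleGraph.dist_eq_one_iff_adj.2 hyw.symm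
      have nadj := hG.not_adj_of_level (p := x) (q := y) (u := v) (v := w) (by lia) (by lia)
        (by lia)
      obtain ⟨u, hvu, hwu, hu⟩ :=
        hG.exists_quadrangle (u := a) hyv hyw hwv.symm nadj (by lia) (by lia)
      have u1 := hG.near hvu x
      have u2 := hG.near hxa u
      refine hwv.symm (hG.eq_of_square_level (p := x) (q := y) hcv hwc.symm hvu.symm hwu.symm
        (by lia) (hG.mem_interval_of_down hvu (by lia) (by lia)) (by lia) (by lia) (by lia)
        (by lia) (by lia) ?_)
      rintro rfl
      lia
    · obtain ⟨t, hyt, hvt, ht⟩ := hG.exists_triangle (u := a) hyv (by lia)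
      have xt : G.dist x t = D := by
        have := hG.near hyt x
        have := hG.near hxa t
        lia
      have htc : t ≠ c := by
        rintro rfl
        lia
      have hnadj : ¬ G.Adj t c := fun hadj => by
        have := hG.near hadj a
        lia
      obtain ⟨u, htu, hcu, hu⟩ :=
        hG.exists_quadrangle (u := x) hvt hcv.symm htc hnadj (by lia) (by lia)
      by_cases hyc : G.Adj y c
      · exact ⟨c, hyc.symm, by lia, by lia, by lia⟩
      have dyc : G.dist y c = 2 := hG.dist_eq_two hyv.symm hcv.symm (by rintro rfl; lia) hyc
      have dyu : G.dist y u = 2 := by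
        refine hG.dist_eq_two hyt.symm htu (by rintro rfl; lia) fun hadj => ?_
        have := hG.near hadj x
        lia
      obtain ⟨w, hcw, huw, hw⟩ := hG.exists_triangle (u := y) hcu (by lia)
      have hyw : G.Adj y w := SimpleGraph.dist_eq_one_iff_adj.1 (by lia)
      have w1 := hG.near hyw x
      have w2 := hG.near huw x
      have hxw : G.dist x w = D := by lia
      have w3 := good hyw hxw
      have w4 := hG.near hyw a
      have w5 := hG.near hcw a
      exact finish hyw hcw hxw (by lia)

theorem CubePair.of_opposite (hG : IsSwm G) {x a y b : V} (hay : CubePair G a y)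
    (hyb : CubePair G y b) (hxa : G.Adj x a) (hy : G.dist x y = G.dist a y + 1)
    (hb : G.dist a b = G.dist x b + 1) : CubePair G x y := by
  obtain ⟨c, hcy, hxc, hac, -⟩ := hyb.exists_opposite hG hxa hy hb
  have hl : Ladder G x a c y (G.dist a y) := ⟨hxa, hcy, hy, hac, hxc, rfl⟩
  exact (hl.symm.cubePair hG hay.symm).1.symm

theorem CubePair.of_not_farther (hG : IsSwm G) {x a y : V} (h : CubePair G a y)
    (hxa : G.Adj x a) (hd : G.dist x y ≤ G.dist a y) : CubePair G x y := by
  have e1 := hG.near hxa y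
  by_cases h1 : G.dist x y = G.dist a y
  · exact h.of_equidistant hG hxa h1
  · exact h.of_atom hG hxa.symm (by lia)

theorem thickeningLe_adj (hG : IsSwm G) {m : ℕ} {x y : V} :
    (thickeningLe G m).Adj x y ↔ x ≠ y ∧ CubePair G x y ∧ G.dist x y ≤ m := by
  rw [thickeningLe, SimpleGraph.fromRel_adj]
  constructor
  · rintro ⟨hne, ⟨h, hd⟩ | ⟨h, hd⟩⟩
    · exact ⟨hne, h.cubePair hG, hd⟩
    · exact ⟨hne, (h.cubePair hG).symm, by rwa [SimpleGraph.dist_comm]⟩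
  · rintro ⟨hne, h, hd⟩
    exact ⟨hne, Or.inl ⟨h.booleanPair hG, hd⟩⟩

/-- A diagonal of an induced square of the thickening with the edge `x a` of `G`. -/
theorem InducedSquare.cubePair (hG : IsSwm G) {m : ℕ} {x a y b : V}
    (h : InducedSquare (thickeningLe G m) x a y b) (hxa : G.Adj x a) :
    CubePair G x y ∧ G.dist x y ≤ m + 1 := by
  obtain ⟨-, hay, hyb, hbx, hxy, hab, nxy, nab⟩ := h
  rw [thickeningLe_adj hG] at hay hyb hbx nxy nab
  obtain ⟨-, hay, day⟩ := hay
  obtain ⟨-, hyb, -⟩ := hyb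
  obtain ⟨-, hbx, dbx⟩ := hbx
  have e1 := hG.near hxa y
  have e2 := hG.near hxa b
  refine ⟨?_, by lia⟩
  by_cases h1 : G.dist x y ≤ G.dist a y
  · exact hay.of_not_farther hG hxa h1
  by_cases h2 : G.dist a b ≤ G.dist x b
  · exact absurd ⟨hab, hbx.symm.of_not_farther hG hxa.symm h2, by lia⟩ nab
  exact hay.of_opposite hG hyb hxa (by lia) (by lia)

theorem InducedSquare.rotate {H : SimpleGraph V} {a b c d : V} (h : InducedSquare H a b c d) :
    InducedSquare H c d a b := by
  obtain ⟨h1, h2, h3, h4, h5, h6, h7, h8⟩ := h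
  exact ⟨h3, h4, h1, h2, h5.symm, h6.symm, fun h => h7 h.symm, fun h => h8 h.symm⟩

theorem InducedSquare.reverse {H : SimpleGraph V} {a b c d : V} (h : InducedSquare H a b c d) :
    InducedSquare H c b a d := by
  obtain ⟨h1, h2, h3, h4, h5, h6, h7, h8⟩ := h
  exact ⟨h2.symm, h1.symm, h4.symm, h3.symm, h5.symm, h6, fun h => h7 h.symm, h8⟩

theorem InducedSquare.thickeningLe_adj (hG : IsSwm G) {m : ℕ} {x a y b : V}
    (h : InducedSquare (thickeningLe G m) x a y b)
    (hadj : G.Adj x a ∨ G.Adj a y ∨ G.Adj y b ∨ G.Adj b x) :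
    (thickeningLe G (m + 1)).Adj x y := by
  have flip (h' : CubePair G y x ∧ G.dist y x ≤ m + 1) : CubePair G x y ∧ G.dist x y ≤ m + 1 :=
    ⟨h'.1.symm, by rw [SimpleGraph.dist_comm]; exact h'.2⟩
  refine (_root_.thickeningLe_adj hG).2 ⟨h.2.2.2.2.1, ?_⟩
  obtain h1 | h1 | h1 | h1 := hadj
  · exact h.cubePair hG h1
  · exact flip (h.reverse.cubePair hG h1.symm)
  · exact flip (h.rotate.cubePair hG h1)
  · exact h.rotate.reverse.cubePair hG h1.symm

/-- A cube pair at distance `n + 2` is a diagonal of an induced square of the thickening. -/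
theorem CubePair.exists_inducedSquare (hG : IsSwm G) {x y : V} {n : ℕ} (h : CubePair G x y)
    (hd : G.dist x y = n + 2) :
    ∃ a b, InducedSquare (thickeningLe G (n + 1)) x a y b ∧ G.Adj x a := by
  obtain ⟨a, b, hl, hxb, hay⟩ := h.exists_ladder hd
  have h1 := hl.dist_ab
  have h2 := hl.dist_pb
  have h3 := hl.dist_aq
  have hxa := SimpleGraph.dist_eq_one_iff_adj.2 hl.left
  have hyb := SimpleGraph.dist_eq_one_iff_adj.2 hl.right.symm
  have hbx := G.dist_comm (u := b) (v := x)
  have ne_of {u v : V} (huv : G.dist u v ≠ 0) : u ≠ v := by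
    rintro rfl
    simp at huv
  refine ⟨a, b, ⟨?_, ?_, ?_, ?_, ne_of (by lia), ne_of (by lia), ?_, ?_⟩, hl.left⟩ <;>
    rw [thickeningLe_adj hG]
  · exact ⟨hl.left.ne, .of_adj hl.left, by lia⟩
  · exact ⟨ne_of (by lia), hay, by lia⟩
  · exact ⟨hl.right.ne', .of_adj hl.right.symm, by lia⟩
  · exact ⟨ne_of (by lia), hxb.symm, by lia⟩
  · lia
  · lia

end

theorem statement19 (G : SimpleGraph V) (hconn : G.Connected)
    (hwm : WeaklyModular G) (h4 : ¬ HasInducedK4minus G)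
    (h33 : ¬ HasIsometricK33minus G) (k : ℕ) :
    diagExt G k = thickeningLe G (k + 1) := by
  have hG : IsSwm G := ⟨hconn, hwm.1, hwm.2, h4, h33⟩
  induction k with
  | zero =>
    ext x y
    rw [thickeningLe_adj hG]
    refine ⟨fun h => ⟨h.ne, .of_adj h, (SimpleGraph.dist_eq_one_iff_adj.2 h).le⟩, ?_⟩
    rintro ⟨hne, -, hd⟩
    have := hG.dist_ne_zero hne
    have h1 : G.Adj x y := SimpleGraph.dist_eq_one_iff_adj.1 (by lia)
    exact h1
  | succ k ih =>
    ext x y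
    rw [diagExt, ih, SimpleGraph.sup_adj, SimpleGraph.fromRel_adj]
    constructor
    · rintro (h | ⟨-, ⟨a, b, hsq, hadj⟩ | ⟨a, b, hsq, hadj⟩⟩)
      · rw [thickeningLe_adj hG] at h ⊢
        exact ⟨h.1, h.2.1, by lia⟩
      · exact hsq.thickeningLe_adj hG hadj
      · exact (hsq.thickeningLe_adj hG hadj).symm
    · intro h
      rw [thickeningLe_adj hG] at h
      obtain ⟨hne, hxy, hd⟩ := h
      by_cases hk : G.dist x y ≤ k + 1
      · exact Or.inl ((thickeningLe_adj hG).2 ⟨hne, hxy, hk⟩)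
      · obtain ⟨a, b, hsq, hxa⟩ := hxy.exists_inducedSquare hG (n := k) (by lia)
        exact Or.inr ⟨hne, Or.inl ⟨a, b, hsq, Or.inl hxa⟩⟩
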